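/- arXiv:1901.03679 — 2 statements merged into one kernel-verified Lean document; each statement's English description precedes it below -/
import Mathlib

section
/- The monic quintic f has two distinct real double roots and one real simple root — i.e., there exist real numbers a1, a2, b, pairwise distinct, with f(X) = (X−a1)^2(X−a2)^2(X−b) — if and only if D = 0, L1 = 0, L2 ≠ 0 and D2 > 0. -/
open Polynomial

noncomputable section

def quinticL2 (p q r s : ℝ) : ℝ :=
  3*p^2*q^2 - 45*r^2 - 8*p^3*r + 40*q*s + 38*p*q*r - 16*p^2*s - 12*q^3

def quinticL1 (p q r s t : ℝ) : ℝ :=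
  -264*p*r*s^2 - 12*p^3*q^2*t + 36*p*q*r^3 - 124*p*q^2*r*s + 28*p^3*q*r*s + 260*p*q*s*t - 132*p^2*q*r*t + 240*p*r^2*t + 234*q*r^2*s + 32*p^4*r*t + 48*p*q^3*t - 56*p^3*s*t - 80*q^2*r*t + 194*p^2*q*s^2 - 600*r*s*t - 6*p^2*q^3*s + 2*p^2*q^2*r^2 - 12*p^2*r^2*s - 54*r^4 + 320*s^3 - 8*q^3*r^2 - 8*p^3*r^3 + 250*q*t^2 - 176*q^2*s^2 + 24*q^4*s - 36*p^4*s^2 - 100*p^2*t^2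

def quinticD2 (p q r s t : ℝ) : ℝ :=
  24*p^2*q^4*s - 1100*q^3*r*t + 800*p^3*q*s*t - 1735*p^2*q^2*r*t - 3*p^2*q*r^2*s + 20*p*q^3*r*s - 600*p^2*r*s*t - 1150*p*q^2*s*t + 5475*p*q*r^2*t - 1380*p*q*r*s^2 + 1500*q*r*s*t + 6*p^3*q*r^3 + p^4*q^2*r^2 - 128*p^6*r*t + 660*p*q^4*t - 136*p^5*s*t - 3*p^4*q^3*s - 236*p^4*q*s^2 + 337*p^2*q^2*s^2 + 48*p^5*q^2*t - 357*p^3*q^3*t - 12*p^4*r^2*s - 45*p*r^3*s + 60*q^2*r^2*s - 8*p^2*q^3*r^2 - 500*p^2*q*t^2 - 24*p*q^2*r^3 - 1380*p^3*r^2*t + 408*p^3*r*s^2 - 4*p^5*q*r*s + 1028*p^4*q*r*t + 11*p^3*q^2*r*s + 36*p^6*s^2 + 100*p^4*t^2 + 9*p^2*r^4 - 48*q^5*s + 16*q^4*r^2 + 160*q^3*s^2 + 625*q^2*t^2 - 3375*r^3*t + 900*r^2*s^2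

theorem monic_quintic_eq_iff {R : Type*} [CommRing R] (p q r s t p' q' r' s' t' : R) :
    (X ^ 5 + C p * X ^ 4 + C q * X ^ 3 + C r * X ^ 2 + C s * X + C t : R[X]) =
        X ^ 5 + C p' * X ^ 4 + C q' * X ^ 3 + C r' * X ^ 2 + C s' * X + C t' ↔
      p = p' ∧ q = q' ∧ r = r' ∧ s = s' ∧ t = t' := by
  constructor
  · intro h
    refine ⟨?_, ?_, ?_, ?_, ?_⟩
    · simpa [coeff_X, coeff_C, coeff_X_pow] using congrArg (fun g => coeff g 4) h
    · simpa [coeff_X, coeff_C, coeff_X_pow] using congrArg (fun g => coeff g 3) h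
    · simpa [coeff_X, coeff_C, coeff_X_pow] using congrArg (fun g => coeff g 2) h
    · simpa [coeff_X, coeff_C, coeff_X_pow] using congrArg (fun g => coeff g 1) h
    · simpa [coeff_X, coeff_C, coeff_X_pow] using congrArg (fun g => coeff g 0) h
  · rintro ⟨rfl, rfl, rfl, rfl, rfl⟩
    rfl

/-- Vieta's formulas for a monic quintic that is a product of linear factors. -/
theorem quintic_eq_prod_iff {R : Type*} [CommRing R] (p q r s t a b c d e : R) :
    (X ^ 5 + C p * X ^ 4 + C q * X ^ 3 + C r * X ^ 2 + C s * X + C t : R[X]) =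
        (X - C a) * (X - C b) * (X - C c) * (X - C d) * (X - C e) ↔
      p = -(a + b + c + d + e) ∧
      q = a * b + a * c + a * d + a * e + b * c + b * d + b * e + c * d + c * e + d * e ∧
      r = -(a * b * c + a * b * d + a * b * e + a * c * d + a * c * e + a * d * e
        + b * c * d + b * c * e + b * d * e + c * d * e) ∧
      s = a * b * c * d + a * b * c * e + a * b * d * e + a * c * d * e + b * c * d * e ∧
      t = -(a * b * c * d * e) := by
  have expand : (X - C a) * (X - C b) * (X - C c) * (X - C d) * (X - C e) =
      X ^ 5 + C (-(a + b + c + d + e)) * X ^ 4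
      + C (a * b + a * c + a * d + a * e + b * c + b * d + b * e + c * d + c * e + d * e) * X ^ 3
      + C (-(a * b * c + a * b * d + a * b * e + a * c * d + a * c * e + a * d * e
        + b * c * d + b * c * e + b * d * e + c * d * e)) * X ^ 2
      + C (a * b * c * d + a * b * c * e + a * b * d * e + a * c * d * e + b * c * d * e) * X
      + C (-(a * b * c * d * e)) := by
    simp only [C_neg, C_add, C_mul]
    ring
  rw [expand, monic_quintic_eq_iff]

theorem quinticL1_eq_of_double_root {p q r s t : ℝ} {a b c d : ℂ}
    (h : (X ^ 5 + C (p : ℂ) * X ^ 4 + C (q : ℂ) * X ^ 3 + C (r : ℂ) * X ^ 2 + C (s : ℂ) * X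
      + C (t : ℂ) : ℂ[X]) = (X - C a) * (X - C a) * (X - C b) * (X - C c) * (X - C d)) :
    (quinticL1 p q r s t : ℂ) =
      2 * ((a - b) * (a - c) * (a - d) * (b - c) * (b - d) * (c - d)) ^ 2 := by
  obtain ⟨hp, hq, hr, hs, ht⟩ := (quintic_eq_prod_iff _ _ _ _ _ _ _ _ _ _).1 h
  simp only [quinticL1]
  push_cast
  rw [hp, hq, hr, hs, ht]
  ring

theorem quinticD2_eq_zero_of_triple_root {p q r s t : ℝ} {a b c : ℂ}
    (h : (X ^ 5 + C (p : ℂ) * X ^ 4 + C (q : ℂ) * X ^ 3 + C (r : ℂ) * X ^ 2 + C (s : ℂ) * X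
      + C (t : ℂ) : ℂ[X]) = (X - C a) * (X - C a) * (X - C a) * (X - C b) * (X - C c)) :
    quinticD2 p q r s t = 0 := by
  obtain ⟨hp, hq, hr, hs, ht⟩ := (quintic_eq_prod_iff _ _ _ _ _ _ _ _ _ _).1 h
  rw [← Complex.ofReal_eq_zero]
  simp only [quinticD2]
  push_cast
  rw [hp, hq, hr, hs, ht]
  ring

theorem quinticD2_eq_of_two_double_roots {p q r s t : ℝ} {a b c : ℂ}
    (h : (X ^ 5 + C (p : ℂ) * X ^ 4 + C (q : ℂ) * X ^ 3 + C (r : ℂ) * X ^ 2 + C (s : ℂ) * X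
      + C (t : ℂ) : ℂ[X]) = (X - C a) * (X - C a) * (X - C b) * (X - C b) * (X - C c)) :
    (quinticD2 p q r s t : ℂ) = 4 * (a - b) ^ 6 * ((a - c) * (b - c)) ^ 4 := by
  obtain ⟨hp, hq, hr, hs, ht⟩ := (quintic_eq_prod_iff _ _ _ _ _ _ _ _ _ _).1 h
  simp only [quinticD2]
  push_cast
  rw [hp, hq, hr, hs, ht]
  ring

theorem quinticL2_eq_of_two_double_roots {p q r s t : ℝ} {a b c : ℂ}
    (h : (X ^ 5 + C (p : ℂ) * X ^ 4 + C (q : ℂ) * X ^ 3 + C (r : ℂ) * X ^ 2 + C (s : ℂ) * X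
      + C (t : ℂ) : ℂ[X]) = (X - C a) * (X - C a) * (X - C b) * (X - C b) * (X - C c)) :
    (quinticL2 p q r s : ℂ) = 4 * ((a - b) * (a - c) * (b - c)) ^ 2 := by
  obtain ⟨hp, hq, hr, hs, -⟩ := (quintic_eq_prod_iff _ _ _ _ _ _ _ _ _ _).1 h
  simp only [quinticL2]
  push_cast
  rw [hp, hq, hr, hs]
  ring

/-- If a real quintic has two double complex roots and `quinticD2` is positive on it, then all its
roots are real. -/
theorem exists_real_roots_of_two_double_roots {p q r s t : ℝ} {a b c : ℂ}
    (h : (X ^ 5 + C (p : ℂ) * X ^ 4 + C (q : ℂ) * X ^ 3 + C (r : ℂ) * X ^ 2 + C (s : ℂ) * X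
      + C (t : ℂ) : ℂ[X]) = (X - C a) * (X - C a) * (X - C b) * (X - C b) * (X - C c))
    (hD2 : 0 < quinticD2 p q r s t) :
    ∃ a1 a2 b : ℝ, a1 ≠ a2 ∧ a1 ≠ b ∧ a2 ≠ b ∧
      (X ^ 5 + C p * X ^ 4 + C q * X ^ 3 + C r * X ^ 2 + C s * X + C t : ℝ[X]) =
        (X - C a1) ^ 2 * (X - C a2) ^ 2 * (X - C b) := by
  have key := quinticD2_eq_of_two_double_roots h
  have hne : (quinticD2 p q r s t : ℂ) ≠ 0 := by exact_mod_cast hD2.ne'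
  rw [key] at hne
  have hab : a ≠ b := by rintro rfl; simp at hne
  have hac : a ≠ c := by rintro rfl; simp at hne
  have hbc : b ≠ c := by rintro rfl; simp at hne
  have heval (x : ℂ) : x ^ 5 + p * x ^ 4 + q * x ^ 3 + r * x ^ 2 + s * x + t =
      (x - a) * (x - a) * (x - b) * (x - b) * (x - c) := by
    simpa using congrArg (eval x) h
  have hconj (x : ℂ) (hx : x = a ∨ x = b ∨ x = c) :
      star x = a ∨ star x = b ∨ star x = c := by
    have h0 : x ^ 5 + p * x ^ 4 + q * x ^ 3 + r * x ^ 2 + s * x + t = 0 := by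
      rw [heval]
      rcases hx with rfl | rfl | rfl <;> ring
    have h1 := heval (star x)
    have h2 := congrArg star h0
    simp only [star_add, star_mul', star_pow, Complex.star_def, Complex.conj_ofReal,
      star_zero] at h1 h2
    rw [h2] at h1
    simpa [sub_eq_zero, or_assoc] using h1.symm
  obtain ⟨hp, -⟩ := (quintic_eq_prod_iff _ _ _ _ _ _ _ _ _ _).1 h
  have hsum : star (a + a + b + b + c) = a + a + b + b + c := by
    have h1 : a + a + b + b + c = ((-p : ℝ) : ℂ) := by
      push_cast
      linear_combination hp
    rw [h1, Complex.star_def, Complex.conj_ofReal]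
  simp only [star_add] at hsum
  have hinj {x y : ℂ} (hxy : star x = star y) : x = y := star_injective hxy
  have hc : star c = c := by
    rcases hconj c (by simp) with hc | hc | hc
    · have ha : star a = c := by rw [← hc, star_star]
      have hb : star b = b := by
        rcases hconj b (by simp) with hb | hb | hb
        · exact absurd (hinj (hb.trans hc.symm)) hbc
        · exact hb
        · exact absurd (hinj (ha.trans hb.symm)) hab
      rw [ha, hb, hc] at hsum
      exact absurd (by linear_combination -hsum) hac
    · have hb : star b = c := by rw [← hc, star_star]
      have ha : star a = a := by
        rcases hconj a (by simp) with ha | ha | ha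
        · exact ha
        · exact absurd (hinj (ha.trans hc.symm)) hac
        · exact absurd (hinj (ha.trans hb.symm)) hab
      rw [ha, hb, hc] at hsum
      exact absurd (by linear_combination -hsum) hbc
    · exact hc
  have ha : star a = a := by
    rcases hconj a (by simp) with ha | ha | ha
    · exact ha
    · exfalso
      obtain ⟨z, rfl⟩ := Complex.conj_eq_iff_real.1 hc
      have h1 : (a - b) ^ 6 = ((-(64 * a.im ^ 6) : ℝ) : ℂ) := by
        have h2 : a - b = 2 * a.im * Complex.I := by
          rw [← ha]
          simpa using Complex.sub_conj a
        have hI : Complex.I ^ 6 = -1 := by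
          rw [show (6 : ℕ) = 2 * 3 from rfl, pow_mul, Complex.I_sq]
          norm_num
        rw [h2, mul_pow, hI]
        push_cast
        ring
      have h3 : (a - z) * (b - z) = ((Complex.normSq (a - z) : ℝ) : ℂ) := by
        rw [← Complex.mul_conj, ← ha]
        simp
      rw [h1, h3] at key
      have h4 : quinticD2 p q r s t =
          4 * (-(64 * a.im ^ 6)) * Complex.normSq (a - z) ^ 4 := by
        exact_mod_cast key
      have h5 : 0 ≤ a.im ^ 6 * Complex.normSq (a - z) ^ 4 := by positivity
      linarith
    · exact absurd (hinj (ha.trans hc.symm)) hac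
  have hb : star b = b := by
    rcases hconj b (by simp) with hb | hb | hb
    · exact absurd (hinj (ha.trans hb.symm)) hab
    · exact hb
    · exact absurd (hinj (hb.trans hc.symm)) hbc
  obtain ⟨x, rfl⟩ := Complex.conj_eq_iff_real.1 ha
  obtain ⟨y, rfl⟩ := Complex.conj_eq_iff_real.1 hb
  obtain ⟨z, rfl⟩ := Complex.conj_eq_iff_real.1 hc
  refine ⟨x, y, z, by exact_mod_cast hab, by exact_mod_cast hac, by exact_mod_cast hbc, ?_⟩
  apply Polynomial.map_injective Complex.ofRealHom Complex.ofReal_injective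
  simpa [pow_two, mul_assoc] using h

/-- A monic quintic with real coefficients and a double complex root for which `quinticL1` vanishes
and `quinticD2` is positive has two real double roots and a real simple root. -/
theorem exists_real_roots_of_double_root {p q r s t : ℝ} {a b c d : ℂ}
    (h : (X ^ 5 + C (p : ℂ) * X ^ 4 + C (q : ℂ) * X ^ 3 + C (r : ℂ) * X ^ 2 + C (s : ℂ) * X
      + C (t : ℂ) : ℂ[X]) = (X - C a) * (X - C a) * (X - C b) * (X - C c) * (X - C d))
    (hL1 : quinticL1 p q r s t = 0) (hD2 : 0 < quinticD2 p q r s t) :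
    ∃ a1 a2 b : ℝ, a1 ≠ a2 ∧ a1 ≠ b ∧ a2 ≠ b ∧
      (X ^ 5 + C p * X ^ 4 + C q * X ^ 3 + C r * X ^ 2 + C s * X + C t : ℝ[X]) =
        (X - C a1) ^ 2 * (X - C a2) ^ 2 * (X - C b) := by
  have key := quinticL1_eq_of_double_root h
  rw [hL1] at key
  have hcases : ((((a = b ∨ a = c) ∨ a = d) ∨ b = c) ∨ b = d) ∨ c = d := by
    simpa [sub_eq_zero] using key.symm
  rcases hcases with ((((rfl | rfl) | rfl) | rfl) | rfl) | rfl
  · exact absurd (quinticD2_eq_zero_of_triple_root h) hD2.ne'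
  · exact absurd (quinticD2_eq_zero_of_triple_root (a := a) (b := b) (c := d)
      (h.trans (by ring))) hD2.ne'
  · exact absurd (quinticD2_eq_zero_of_triple_root (a := a) (b := b) (c := c)
      (h.trans (by ring))) hD2.ne'
  · exact exists_real_roots_of_two_double_roots h hD2
  · exact exists_real_roots_of_two_double_roots (a := a) (b := b) (c := c)
      (h.trans (by ring)) hD2
  · exact exists_real_roots_of_two_double_roots (a := a) (b := c) (c := b)
      (h.trans (by ring)) hD2

theorem quintic_two_real_doubles_one_single (p q r s t D : ℝ) (z : Fin 5 → ℂ)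
    (hf : (X ^ 5 + C (p : ℂ) * X ^ 4 + C (q : ℂ) * X ^ 3 + C (r : ℂ) * X ^ 2 + C (s : ℂ) * X + C (t : ℂ) : Polynomial ℂ) = ∏ i : Fin 5, (X - C (z i)))
    (hD : (D : ℂ) = ∏ i : Fin 5, ∏ j ∈ Finset.Ioi i, (z i - z j) ^ 2) :
    (∃ a1 a2 b : ℝ, a1 ≠ a2 ∧ a1 ≠ b ∧ a2 ≠ b ∧
      (X ^ 5 + C p * X ^ 4 + C q * X ^ 3 + C r * X ^ 2 + C s * X + C t : Polynomial ℝ) =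
        (X - C a1) ^ 2 * (X - C a2) ^ 2 * (X - C b)) ↔
    (D = 0 ∧ quinticL1 p q r s t = 0 ∧ quinticL2 p q r s ≠ 0 ∧ 0 < quinticD2 p q r s t) := by
  constructor
  · rintro ⟨a1, a2, b, h12, h1b, h2b, h⟩
    have hc : (X ^ 5 + C (p : ℂ) * X ^ 4 + C (q : ℂ) * X ^ 3 + C (r : ℂ) * X ^ 2 + C (s : ℂ) * X
        + C (t : ℂ) : ℂ[X]) = (X - C (a1 : ℂ)) * (X - C (a1 : ℂ)) * (X - C (a2 : ℂ))
          * (X - C (a2 : ℂ)) * (X - C (b : ℂ)) := by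
      simpa [pow_two, mul_assoc] using congrArg (Polynomial.map Complex.ofRealHom) h
    refine ⟨?_, ?_, ?_, ?_⟩
    · by_contra hD0
      have hz : Function.Injective z := by
        have hne : ∀ i j, i < j → z i ≠ z j := by
          intro i j hij hzij
          apply hD0
          rw [← Complex.ofReal_eq_zero, hD]
          refine Finset.prod_eq_zero (Finset.mem_univ i) ?_
          exact Finset.prod_eq_zero (Finset.mem_Ioi.2 hij) (by simp [hzij])
        intro i j hzij
        rcases lt_trichotomy i j with hij | hij | hij
        · exact absurd hzij (hne i j hij)
        · exact hij
        · exact absurd hzij.symm (hne j i hij)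
      have hsep : (∏ i : Fin 5, (X - C (z i))).Separable :=
        separable_prod_X_sub_C_iff.2 hz
      have hunit := hsep.squarefree (X - C (a1 : ℂ)) ⟨_, by
        rw [← hf, hc, mul_assoc, mul_assoc]⟩
      exact not_isUnit_X_sub_C _ hunit
    · have h1 := quinticL1_eq_of_double_root hc
      rw [← Complex.ofReal_eq_zero, h1]
      ring
    · have h1 := quinticL2_eq_of_two_double_roots hc
      have h2 : quinticL2 p q r s = 4 * ((a1 - a2) * (a1 - b) * (a2 - b)) ^ 2 := by
        exact_mod_cast h1
      rw [h2]
      simp [sub_eq_zero, h12, h1b, h2b]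
    · have h1 := quinticD2_eq_of_two_double_roots hc
      have h2 : quinticD2 p q r s t = 4 * (a1 - a2) ^ 6 * ((a1 - b) * (a2 - b)) ^ 4 := by
        exact_mod_cast h1
      rw [h2]
      have := sub_ne_zero.2 h12
      have := sub_ne_zero.2 h1b
      have := sub_ne_zero.2 h2b
      positivity
  · rintro ⟨rfl, hL1, -, hD2⟩
    rw [Complex.ofReal_zero, eq_comm, Finset.prod_eq_zero_iff] at hD
    obtain ⟨i, -, hi⟩ := hD
    obtain ⟨j, hj, hij⟩ := Finset.prod_eq_zero_iff.1 hi
    have hlt := Finset.mem_Ioi.1 hj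
    have hzij : z i = z j := by simpa [sub_eq_zero] using hij
    obtain ⟨σ, hσ0, hσ1⟩ : ∃ σ : Equiv.Perm (Fin 5), σ 0 = i ∧ σ 1 = j := by
      clear hi hj hij hzij
      revert i j
      decide
    rw [← Equiv.prod_comp σ, Fin.prod_univ_five, hσ0, hσ1, ← hzij] at hf
    exact exists_real_roots_of_double_root hf hL1 hD2
end
end

section
/- The monic quintic f has one real triple root and one pair of nonreal complex-conjugate simple roots — i.e., there exist a real number a and a nonreal w ∈ ℂ with f(X) = (X−a)^3(X−w)(X−conj(w)) over ℂ — if and only if D = 0, L1 = 0, L2 < 0 and D2 = 0. -/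
open Polynomial

noncomputable section

theorem monic_quintic_coeff_eq {p q r s t p' q' r' s' t' : ℂ}
    (h : (X ^ 5 + C p * X ^ 4 + C q * X ^ 3 + C r * X ^ 2 + C s * X + C t : Polynomial ℂ) =
      X ^ 5 + C p' * X ^ 4 + C q' * X ^ 3 + C r' * X ^ 2 + C s' * X + C t') :
    p = p' ∧ q = q' ∧ r = r' ∧ s = s' ∧ t = t' := by
  have coeff_eq (n : ℕ) := congrArg (fun g : Polynomial ℂ => g.coeff n) h
  refine ⟨?_, ?_, ?_, ?_, ?_⟩
  · simpa [coeff_X, coeff_C, coeff_X_pow] using coeff_eq 4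
  · simpa [coeff_X, coeff_C, coeff_X_pow] using coeff_eq 3
  · simpa [coeff_X, coeff_C, coeff_X_pow] using coeff_eq 2
  · simpa [coeff_X, coeff_C, coeff_X_pow] using coeff_eq 1
  · simpa [coeff_X, coeff_C, coeff_X_pow] using coeff_eq 0

theorem quintic_vieta {p q r s t a b c d e : ℂ}
    (h : (X ^ 5 + C p * X ^ 4 + C q * X ^ 3 + C r * X ^ 2 + C s * X + C t : Polynomial ℂ) =
      (X - C a) * (X - C b) * (X - C c) * (X - C d) * (X - C e)) :
    p = -(a + b + c + d + e) ∧
    q = a * b + a * c + a * d + a * e + b * c + b * d + b * e + c * d + c * e + d * e ∧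
    r = -(a * b * c + a * b * d + a * b * e + a * c * d + a * c * e + a * d * e + b * c * d +
      b * c * e + b * d * e + c * d * e) ∧
    s = a * b * c * d + a * b * c * e + a * b * d * e + a * c * d * e + b * c * d * e ∧
    t = -(a * b * c * d * e) := by
  refine monic_quintic_coeff_eq (h.trans ?_)
  simp only [C_add, C_neg, C_mul]
  ring

theorem quinticL1_of_double_root {p q r s t : ℝ} {a b c d : ℂ}
    (h : (X ^ 5 + C (p : ℂ) * X ^ 4 + C (q : ℂ) * X ^ 3 + C (r : ℂ) * X ^ 2 + C (s : ℂ) * X +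
      C (t : ℂ) : Polynomial ℂ) = (X - C a) ^ 2 * (X - C b) * (X - C c) * (X - C d)) :
    (quinticL1 p q r s t : ℂ) =
      2 * ((a - b) * (a - c) * (a - d) * (b - c) * (b - d) * (c - d)) ^ 2 := by
  obtain ⟨hp, hq, hr, hs, ht⟩ :=
    quintic_vieta (a := a) (b := a) (c := b) (d := c) (e := d) (h.trans (by ring))
  simp only [quinticL1]
  push_cast
  rw [hp, hq, hr, hs, ht]
  ring

theorem quinticL2_of_triple_root {p q r s t : ℝ} {a b c : ℂ}
    (h : (X ^ 5 + C (p : ℂ) * X ^ 4 + C (q : ℂ) * X ^ 3 + C (r : ℂ) * X ^ 2 + C (s : ℂ) * X +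
      C (t : ℂ) : Polynomial ℂ) = (X - C a) ^ 3 * (X - C b) * (X - C c)) :
    (quinticL2 p q r s : ℂ) = 3 * ((a - b) * (a - c) * (b - c)) ^ 2 := by
  obtain ⟨hp, hq, hr, hs, -⟩ :=
    quintic_vieta (a := a) (b := a) (c := a) (d := b) (e := c) (h.trans (by ring))
  simp only [quinticL2]
  push_cast
  rw [hp, hq, hr, hs]
  ring

theorem quinticL2_of_two_double_roots {p q r s t : ℝ} {a b c : ℂ}
    (h : (X ^ 5 + C (p : ℂ) * X ^ 4 + C (q : ℂ) * X ^ 3 + C (r : ℂ) * X ^ 2 + C (s : ℂ) * X +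
      C (t : ℂ) : Polynomial ℂ) = (X - C a) ^ 2 * (X - C b) ^ 2 * (X - C c)) :
    (quinticL2 p q r s : ℂ) = 4 * ((a - b) * (a - c) * (b - c)) ^ 2 := by
  obtain ⟨hp, hq, hr, hs, -⟩ :=
    quintic_vieta (a := a) (b := a) (c := b) (d := b) (e := c) (h.trans (by ring))
  simp only [quinticL2]
  push_cast
  rw [hp, hq, hr, hs]
  ring

theorem quinticD2_of_triple_root {p q r s t : ℝ} {a b c : ℂ}
    (h : (X ^ 5 + C (p : ℂ) * X ^ 4 + C (q : ℂ) * X ^ 3 + C (r : ℂ) * X ^ 2 + C (s : ℂ) * X +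
      C (t : ℂ) : Polynomial ℂ) = (X - C a) ^ 3 * (X - C b) * (X - C c)) :
    quinticD2 p q r s t = 0 := by
  obtain ⟨hp, hq, hr, hs, ht⟩ :=
    quintic_vieta (a := a) (b := a) (c := a) (d := b) (e := c) (h.trans (by ring))
  rw [← Complex.ofReal_eq_zero]
  simp only [quinticD2]
  push_cast
  rw [hp, hq, hr, hs, ht]
  ring

theorem quinticD2_of_two_double_roots {p q r s t : ℝ} {a b c : ℂ}
    (h : (X ^ 5 + C (p : ℂ) * X ^ 4 + C (q : ℂ) * X ^ 3 + C (r : ℂ) * X ^ 2 + C (s : ℂ) * X +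
      C (t : ℂ) : Polynomial ℂ) = (X - C a) ^ 2 * (X - C b) ^ 2 * (X - C c)) :
    (quinticD2 p q r s t : ℂ) = 4 * (a - b) ^ 6 * ((a - c) * (b - c)) ^ 4 := by
  obtain ⟨hp, hq, hr, hs, ht⟩ :=
    quintic_vieta (a := a) (b := a) (c := b) (d := b) (e := c) (h.trans (by ring))
  simp only [quinticD2]
  push_cast
  rw [hp, hq, hr, hs, ht]
  ring

theorem prod_sub_sq_eq_zero_iff (z : Fin 5 → ℂ) :
    ∏ i : Fin 5, ∏ j ∈ Finset.Ioi i, (z i - z j) ^ 2 = 0 ↔ ¬ Function.Injective z := by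
  simp only [Finset.prod_eq_zero_iff, Finset.mem_univ, true_and, Finset.mem_Ioi, pow_eq_zero_iff,
    ne_eq, OfNat.ofNat_ne_zero, not_false_eq_true, sub_eq_zero]
  constructor
  · rintro ⟨i, j, hij, h⟩ hz
    exact hij.ne (hz h)
  · intro hz
    simp only [Function.Injective, not_forall] at hz
    obtain ⟨i, j, h, hij⟩ := hz
    rcases lt_or_gt_of_ne hij with hlt | hlt
    · exact ⟨i, j, hlt, h⟩
    · exact ⟨j, i, hlt, h.symm⟩

theorem exists_double_root_of_not_injective {z : Fin 5 → ℂ} (hz : ¬ Function.Injective z) :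
    ∃ a b c d : ℂ, ∏ i : Fin 5, (X - C (z i)) =
      (X - C a) ^ 2 * (X - C b) * (X - C c) * (X - C d) := by
  have hdisc := (prod_sub_sq_eq_zero_iff z).2 hz
  simp only [Finset.prod_eq_zero_iff, Finset.mem_univ, true_and, Finset.mem_Ioi, pow_eq_zero_iff,
    ne_eq, OfNat.ofNat_ne_zero, not_false_eq_true, sub_eq_zero] at hdisc
  obtain ⟨i, j, hij, h⟩ := hdisc
  obtain ⟨k, l, m, huniv⟩ : ∃ k l m : Fin 5, (Finset.univ : Finset (Fin 5)).val =
      {i, j, k, l, m} := by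
    clear h
    revert i j
    decide
  refine ⟨z i, z k, z l, z m, ?_⟩
  rw [Finset.prod, huniv]
  simp only [Multiset.insert_eq_cons, Multiset.map_cons, Multiset.map_singleton,
    Multiset.prod_cons, Multiset.prod_singleton, ← h]
  ring

theorem triple_root_or_two_double_roots {a b c d : ℂ}
    (h : (a - b) * (a - c) * (a - d) * (b - c) * (b - d) * (c - d) = 0) :
    (∃ u v w : ℂ, (X - C a) ^ 2 * (X - C b) * (X - C c) * (X - C d) =
      (X - C u) ^ 3 * (X - C v) * (X - C w)) ∨
    (∃ u v w : ℂ, (X - C a) ^ 2 * (X - C b) * (X - C c) * (X - C d) =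
      (X - C u) ^ 2 * (X - C v) ^ 2 * (X - C w)) := by
  simp only [mul_eq_zero, sub_eq_zero] at h
  rcases h with ((((rfl | rfl) | rfl) | rfl) | rfl) | rfl
  · exact .inl ⟨a, c, d, by ring⟩
  · exact .inl ⟨a, b, d, by ring⟩
  · exact .inl ⟨a, b, c, by ring⟩
  · exact .inr ⟨a, b, d, by ring⟩
  · exact .inr ⟨a, b, c, by ring⟩
  · exact .inr ⟨a, c, b, by ring⟩

/-- The conjugate of a triple root is again a multiple root, hence equal to it as soon as the other
two roots are simple. -/
theorem conj_eq_of_triple_root {p q r s t : ℝ} {a b c : ℂ}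
    (h : (X ^ 5 + C (p : ℂ) * X ^ 4 + C (q : ℂ) * X ^ 3 + C (r : ℂ) * X ^ 2 + C (s : ℂ) * X +
      C (t : ℂ) : Polynomial ℂ) = (X - C a) ^ 3 * (X - C b) * (X - C c))
    (hab : a ≠ b) (hac : a ≠ c) (hbc : b ≠ c) : (starRingEnd ℂ) a = a := by
  have hconj := congrArg (Polynomial.map (starRingEnd ℂ)) h
  simp only [Polynomial.map_add, Polynomial.map_mul, Polynomial.map_pow, Polynomial.map_sub,
    map_X, map_C, Complex.conj_ofReal] at hconj
  rw [h] at hconj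
  have heval := congrArg (eval ((starRingEnd ℂ) a)) hconj
  have hderiv := congrArg (fun g => eval ((starRingEnd ℂ) a) (derivative g)) hconj
  simp [sub_eq_zero] at heval
  rcases heval with (heval | heval) | heval
  · exact heval
  · rw [heval] at hderiv
    simp [derivative_X_sub_C_pow, sub_eq_zero, hab.symm, hbc] at hderiv
  · rw [heval] at hderiv
    simp [derivative_X_sub_C_pow, sub_eq_zero, hac.symm, hbc.symm] at hderiv

theorem conj_pair_of_triple_root {p q r s t : ℝ} {a b c : ℂ}
    (h : (X ^ 5 + C (p : ℂ) * X ^ 4 + C (q : ℂ) * X ^ 3 + C (r : ℂ) * X ^ 2 + C (s : ℂ) * X +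
      C (t : ℂ) : Polynomial ℂ) = (X - C a) ^ 3 * (X - C b) * (X - C c))
    (hL2 : quinticL2 p q r s < 0) :
    a.im = 0 ∧ b.im ≠ 0 ∧ c = (starRingEnd ℂ) b := by
  have hL := quinticL2_of_triple_root h
  have hne : (a - b) * (a - c) * (b - c) ≠ 0 := by
    intro h0
    rw [h0] at hL
    norm_num at hL
    exact hL2.ne hL
  simp only [ne_eq, mul_eq_zero, sub_eq_zero, not_or] at hne
  have ha := Complex.conj_eq_iff_im.1 (conj_eq_of_triple_root h hne.1.1 hne.1.2 hne.2)
  obtain ⟨hp, hq, -⟩ :=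
    quintic_vieta (a := a) (b := a) (c := a) (d := b) (e := c) (h.trans (by ring))
  have him : c.im = -b.im := by
    have := congrArg Complex.im hp
    simp [ha] at this
    linarith
  have hre : b.im * (c.re - b.re) = 0 := by
    have := congrArg Complex.im hq
    simp [ha, him] at this
    linarith
  have hb : b.im ≠ 0 := by
    intro hb
    have ea : a = (a.re : ℂ) := Complex.ext rfl (by simpa using ha)
    have eb : b = (b.re : ℂ) := Complex.ext rfl (by simpa using hb)
    have ec : c = (c.re : ℂ) := Complex.ext rfl (by simpa [hb] using him)
    rw [ea, eb, ec] at hL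
    norm_cast at hL
    have := sq_nonneg ((a.re - b.re) * (a.re - c.re) * (b.re - c.re))
    linarith
  refine ⟨ha, hb, Complex.ext ?_ him⟩
  simpa using sub_eq_zero.1 ((mul_eq_zero.1 hre).resolve_left hb)

theorem quinticL2_neg_of_conj_pair {p q r s t a : ℝ} {w : ℂ} (hw : w.im ≠ 0)
    (h : (X ^ 5 + C (p : ℂ) * X ^ 4 + C (q : ℂ) * X ^ 3 + C (r : ℂ) * X ^ 2 + C (s : ℂ) * X +
      C (t : ℂ) : Polynomial ℂ) =
        (X - C (a : ℂ)) ^ 3 * (X - C w) * (X - C ((starRingEnd ℂ) w))) :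
    quinticL2 p q r s < 0 := by
  have hL := quinticL2_of_triple_root h
  have hnorm : ((a : ℂ) - w) * (a - (starRingEnd ℂ) w) =
      (((a - w.re) ^ 2 + w.im ^ 2 : ℝ) : ℂ) := by
    apply Complex.ext
    · simp [pow_two]
    · simp [pow_two]
      ring
  rw [mul_pow, hnorm, Complex.sub_conj, mul_pow, Complex.I_sq] at hL
  norm_cast at hL
  have hpos : 0 < (a - w.re) ^ 2 + w.im ^ 2 := by positivity
  have : 0 < ((a - w.re) ^ 2 + w.im ^ 2) ^ 2 * (2 * w.im) ^ 2 := by positivity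
  push_cast at hL
  linarith

theorem quintic_triple_conj_pair (p q r s t D : ℝ) (z : Fin 5 → ℂ)
    (hf : (X ^ 5 + C (p : ℂ) * X ^ 4 + C (q : ℂ) * X ^ 3 + C (r : ℂ) * X ^ 2 + C (s : ℂ) * X + C (t : ℂ) : Polynomial ℂ) = ∏ i : Fin 5, (X - C (z i)))
    (hD : (D : ℂ) = ∏ i : Fin 5, ∏ j ∈ Finset.Ioi i, (z i - z j) ^ 2) :
    (∃ (a : ℝ) (w : ℂ), w.im ≠ 0 ∧
      (X ^ 5 + C (p : ℂ) * X ^ 4 + C (q : ℂ) * X ^ 3 + C (r : ℂ) * X ^ 2 + C (s : ℂ) * X + C (t : ℂ) : Polynomial ℂ) =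
        (X - C (a : ℂ)) ^ 3 * (X - C w) * (X - C ((starRingEnd ℂ) w))) ↔
    (D = 0 ∧ quinticL1 p q r s t = 0 ∧ quinticL2 p q r s < 0 ∧ quinticD2 p q r s t = 0) := by
  have hD0 : D = 0 ↔ ¬ Function.Injective z := by
    rw [← prod_sub_sq_eq_zero_iff, ← hD, Complex.ofReal_eq_zero]
  constructor
  · rintro ⟨a, w, hw, h⟩
    refine ⟨hD0.2 fun hz => ?_, ?_, quinticL2_neg_of_conj_pair hw h, quinticD2_of_triple_root h⟩
    · have hsq := (separable_prod_X_sub_C_iff.2 hz).squarefree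
      rw [← hf, h] at hsq
      exact not_isUnit_X_sub_C (a : ℂ) (hsq _ ⟨(X - C (a : ℂ)) * (X - C w) *
        (X - C ((starRingEnd ℂ) w)), by ring⟩)
    · have hL1 := quinticL1_of_double_root (a := a) (b := a) (c := w) (d := (starRingEnd ℂ) w)
        (h.trans (by ring))
      simpa using hL1
  · rintro ⟨hD', hL1, hL2, hD2⟩
    obtain ⟨a, b, c, d, hz⟩ := exists_double_root_of_not_injective (hD0.1 hD')
    have h := hf.trans hz
    have hdisc := quinticL1_of_double_root h
    rw [hL1, Complex.ofReal_zero, eq_comm, mul_eq_zero, pow_eq_zero_iff two_ne_zero] at hdisc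
    rcases triple_root_or_two_double_roots (hdisc.resolve_left two_ne_zero) with
      ⟨u, v, w, huvw⟩ | ⟨u, v, w, huvw⟩
    · have h3 := h.trans huvw
      obtain ⟨hu, hv, rfl⟩ := conj_pair_of_triple_root h3 hL2
      have eu : u = (u.re : ℂ) := Complex.ext rfl (by simpa using hu)
      exact ⟨u.re, v, hv, by rw [h3, ← eu]⟩
    · have h22 := h.trans huvw
      have hzero := quinticD2_of_two_double_roots h22
      have hL := quinticL2_of_two_double_roots h22
      have hprod : (u - v) * (u - w) * (v - w) = 0 := by
        simpa [hD2, or_assoc] using hzero.symm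
      rw [hprod] at hL
      norm_num at hL
      exact absurd hL hL2.ne
end
end
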